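/- For sufficiently small k² > 0 and sufficiently small λ/k > 0 (so that f(λ/k) < 1 and λ < (2/π)k fails to be violated: 0 < λ ≤ (2/π)k), there exists a neighborhood N of π/2 such that for every φ₀ ∈ N with φ₀ < π/2 there exist c ∈ (0, 2λ) and a solution (ρ, z, φ) of ρ' = 2k tanh z sin ρ − 2λ sech z cos φ + c, z' = k cos ρ, φ' = k sin ρ with ρ(0) = z(0) = 0, φ(0) = φ₀, such that |ρ(ξ)| < π/2 for all ξ ≥ 0 and z(ξ) → +∞ monotonically: a traveling domain wall exists. -/

import Mathlib

open Filter Topology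

section helpers

open Set

theorem tdw_global_exists {E : Type*} [NormedAddCommGroup E] [NormedSpace ℝ E] [CompleteSpace E]
    (F : E → E) (K M : NNReal) (hK : LipschitzWith K F) (hM : ∀ x, ‖F x‖ ≤ M) (x₀ : E) :
    ∃ γ : ℝ → E, γ 0 = x₀ ∧ ∀ t, HasDerivAt γ (F (γ t)) t := by
  have hloc : ∀ n : ℕ, ∃ γ : ℝ → E, γ 0 = x₀ ∧
      ∀ t ∈ Ioo (-((n:ℝ)+1)) ((n:ℝ)+1), HasDerivAt γ (F (γ t)) t := by
    intro n
    have h0 : (0:ℝ) ∈ Icc (-((n:ℝ)+1)) ((n:ℝ)+1) := by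
      constructor <;> linarith [Nat.cast_nonneg (α := ℝ) n]
    have hP : IsPicardLindelof (fun _ => F) (⟨0, h0⟩ : Icc (-((n:ℝ)+1)) ((n:ℝ)+1)) x₀
        (M * ((n:NNReal)+1)) 0 M K := by
      refine ⟨fun t _ => hK.lipschitzOnWith, fun x _ => continuousOn_const,
        fun t _ x _ => hM x, ?_⟩
      simp
    obtain ⟨γ, h1, h2⟩ := hP.exists_eq_forall_mem_Icc_hasDerivWithinAt₀
    refine ⟨γ, h1, fun t ht => ?_⟩
    exact (h2 t (Ioo_subset_Icc_self ht)).hasDerivAt (Icc_mem_nhds ht.1 ht.2)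
  choose γ hγ0 hγ using hloc
  have huniq : ∀ m n : ℕ, m ≤ n → EqOn (γ m) (γ n) (Ioo (-((m:ℝ)+1)) ((m:ℝ)+1)) := by
    intro m n hmn
    have hmn' : (m:ℝ) ≤ n := by exact_mod_cast hmn
    have hm : (0:ℝ) ≤ m := Nat.cast_nonneg m
    refine ODE_solution_unique_of_mem_Ioo (K := K) (v := fun _ => F) (s := fun _ => univ) (t₀ := 0)
      (fun t _ => hK.lipschitzOnWith) (by constructor <;> linarith)
      (fun t ht => ⟨hγ m t ht, trivial⟩)
      (fun t ht => ⟨hγ n t ⟨by linarith [ht.1], by linarith [ht.2]⟩, trivial⟩)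
      (by rw [hγ0, hγ0])
  have hmem : ∀ t : ℝ, t ∈ Ioo (-((⌈|t|⌉₊:ℝ)+1)) ((⌈|t|⌉₊:ℝ)+1) := by
    intro t
    have := Nat.le_ceil |t|
    constructor
    · linarith [neg_abs_le t]
    · linarith [le_abs_self t]
  have heq : ∀ (n : ℕ) (t : ℝ), t ∈ Ioo (-((n:ℝ)+1)) ((n:ℝ)+1) → γ ⌈|t|⌉₊ t = γ n t := by
    intro n t ht
    rcases le_total n ⌈|t|⌉₊ with h | h
    · exact (huniq _ _ h ht).symm
    · exact huniq _ _ h (hmem t)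
  refine ⟨fun t => γ ⌈|t|⌉₊ t, hγ0 _, fun t => ?_⟩
  refine (hγ _ t (hmem t)).congr_of_eventuallyEq ?_
  filter_upwards [Ioo_mem_nhds (hmem t).1 (hmem t).2] with s hs
  exact heq _ s hs

theorem tdw_dep {E : Type*} [NormedAddCommGroup E] [NormedSpace ℝ E]
    (F : E → E) (K : NNReal) (hK : LipschitzWith K F) (w : E)
    (γ : ℝ → ℝ → E) (x₀ : E) (h0 : ∀ c, γ c 0 = x₀)
    (hγ : ∀ c t, HasDerivAt (γ c) (F (γ c t) + c • w) t) (T : ℝ) (c₀ : ℝ) (δ : ℝ) (hδ : 0 < δ) :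
    ∀ᶠ c in 𝓝 c₀, ∀ t ∈ Icc 0 T, dist (γ c t) (γ c₀ t) < δ := by
  have hcont : ∀ c, Continuous (γ c) := fun c =>
    continuous_iff_continuousAt.2 fun t => (hγ c t).continuousAt
  have key : ∀ c, ∀ t ∈ Icc 0 T, dist (γ c t) (γ c₀ t) ≤ gronwallBound 0 K (‖(c - c₀) • w‖ + 0) (t-0) := by
    intro c
    have hK' : LipschitzWith K (fun x => F x + c₀ • w) := by
      intro x y
      simpa using! hK x y
    refine dist_le_of_approx_trajectories_ODE (v := fun _ x => F x + c₀ • w) (fun t => hK')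
      (hcont c).continuousOn (fun t _ => (hγ c t).hasDerivWithinAt) (fun t _ => ?_)
      (hcont c₀).continuousOn (fun t _ => (hγ c₀ t).hasDerivWithinAt) (fun t _ => ?_) ?_
    · rw [dist_eq_norm, sub_smul]; apply le_of_eq; congr 1; abel
    · simp
    · simp [h0]
  have hlim : Tendsto (fun c => gronwallBound 0 K (‖(c - c₀) • w‖ + 0) T) (𝓝 c₀) (𝓝 0) := by
    have : Continuous (fun c : ℝ => gronwallBound 0 K (‖(c - c₀) • w‖ + 0) T) :=
      (gronwallBound_continuous_ε 0 K T).comp (by fun_prop)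
    have h := this.tendsto c₀
    simpa [gronwallBound_ε0_δ0] using h
  filter_upwards [hlim.eventually (gt_mem_nhds hδ)] with c hc t ht
  refine lt_of_le_of_lt ((key c t ht).trans ?_) hc
  refine gronwallBound_mono le_rfl (by positivity) K.2 ?_
  linarith [ht.2]

theorem tdw_hasDerivAt_tanh (x : ℝ) : HasDerivAt Real.tanh (1 / Real.cosh x ^ 2) x := by
  have hc : Real.cosh x ≠ 0 := (Real.cosh_pos x).ne'
  have h := (Real.hasDerivAt_sinh x).div (Real.hasDerivAt_cosh x) hc
  have he : (Real.sinh / Real.cosh) = Real.tanh := by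
    funext y; simp [Real.tanh_eq_sinh_div_cosh]
  rw [he] at h
  refine h.congr_deriv ?_
  have := Real.cosh_sq x
  congr 1
  nlinarith

theorem tdw_tanh_lip (x y : ℝ) : |Real.tanh x - Real.tanh y| ≤ |x - y| := by
  have h : LipschitzWith 1 Real.tanh := by
    refine lipschitzWith_of_nnnorm_deriv_le (fun x => (tdw_hasDerivAt_tanh x).differentiableAt) ?_
    intro x
    rw [(tdw_hasDerivAt_tanh x).deriv, ← NNReal.coe_le_coe, coe_nnnorm, Real.norm_eq_abs,
      abs_of_nonneg (by positivity)]
    have := Real.one_le_cosh x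
    rw [div_le_iff₀ (by positivity)]
    simp only [NNReal.coe_one]
    nlinarith
  simpa [Real.dist_eq] using h.dist_le_mul x y

theorem tdw_hasDerivAt_sech (x : ℝ) :
    HasDerivAt (fun x => (Real.cosh x)⁻¹) (-Real.sinh x / Real.cosh x ^ 2) x :=
  (Real.hasDerivAt_cosh x).inv (Real.cosh_pos x).ne'

theorem tdw_sech_lip (x y : ℝ) : |(Real.cosh x)⁻¹ - (Real.cosh y)⁻¹| ≤ |x - y| := by
  have h : LipschitzWith 1 (fun x => (Real.cosh x)⁻¹) := by
    refine lipschitzWith_of_nnnorm_deriv_le (fun x => (tdw_hasDerivAt_sech x).differentiableAt) ?_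
    intro x
    rw [(tdw_hasDerivAt_sech x).deriv, ← NNReal.coe_le_coe, coe_nnnorm, Real.norm_eq_abs,
      abs_div, abs_of_pos (by have := Real.cosh_pos x; positivity : 0 < Real.cosh x ^ 2), abs_neg]
    have := Real.one_le_cosh x
    rw [div_le_iff₀ (by positivity)]
    simp only [NNReal.coe_one]
    have h2 := Real.cosh_sq x
    rw [one_mul]
    refine abs_le_of_sq_le_sq ?_ (by positivity)
    nlinarith [sq_nonneg (Real.cosh x)]
  simpa [Real.dist_eq] using h.dist_le_mul x y

theorem tdw_sech_bd (x : ℝ) : 0 < (Real.cosh x)⁻¹ ∧ (Real.cosh x)⁻¹ ≤ 1 :=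
  ⟨inv_pos.2 (Real.cosh_pos x), inv_le_one_of_one_le₀ (Real.one_le_cosh x)⟩

theorem tdw_mul_lip {a b a' b' d : ℝ} (ha : |a| ≤ 1) (hb : |b'| ≤ 1) (h1 : |a - a'| ≤ d)
    (h2 : |b - b'| ≤ d) : |a * b - a' * b'| ≤ 2 * d := by
  have : a * b - a' * b' = a * (b - b') + (a - a') * b' := by ring
  rw [this]
  refine (abs_add_le _ _).trans ?_
  rw [abs_mul, abs_mul]
  have e1 := mul_le_mul ha h2 (abs_nonneg _) zero_le_one
  have e2 := mul_le_mul h1 hb (abs_nonneg _) ((abs_nonneg _).trans h1)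
  linarith

theorem tdw_family (μ φ₀ : ℝ) (hμ : 0 < μ) : ∃ R Z P : ℝ → ℝ → ℝ,
    (∀ c, R c 0 = 0 ∧ Z c 0 = 0 ∧ P c 0 = φ₀) ∧
    (∀ c t, HasDerivAt (R c) (2 * Real.tanh (Z c t) * Real.sin (R c t)
        - 2 * μ * (Real.cosh (Z c t))⁻¹ * Real.cos (P c t) + c) t) ∧
    (∀ c t, HasDerivAt (Z c) (Real.cos (R c t)) t) ∧
    (∀ c t, HasDerivAt (P c) (Real.sin (R c t)) t) ∧
    (∀ T c₀ δ : ℝ, 0 < δ → ∀ᶠ c in 𝓝 c₀, ∀ t ∈ Icc 0 T,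
      |R c t - R c₀ t| < δ ∧ |Z c t - Z c₀ t| < δ) := by
  let F : ℝ × ℝ × ℝ → ℝ × ℝ × ℝ := fun x =>
    (2 * Real.tanh x.2.1 * Real.sin x.1 - 2 * μ * (Real.cosh x.2.1)⁻¹ * Real.cos x.2.2,
      Real.cos x.1, Real.sin x.1)
  have hK : LipschitzWith (4 + 4 * ⟨μ, hμ.le⟩ : NNReal) F := by
    refine LipschitzWith.of_dist_le_mul fun x y => ?_
    have hd0 : 0 ≤ dist x y := dist_nonneg
    have h1 : |x.1 - y.1| ≤ dist x y := by
      rw [Prod.dist_eq, ← Real.dist_eq]; exact le_max_left _ _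
    have h2 : |x.2.1 - y.2.1| ≤ dist x y := by
      rw [Prod.dist_eq, Prod.dist_eq, ← Real.dist_eq]
      exact (le_max_left _ _).trans (le_max_right _ _)
    have h3 : |x.2.2 - y.2.2| ≤ dist x y := by
      rw [Prod.dist_eq, Prod.dist_eq, ← Real.dist_eq]
      exact (le_max_right _ _).trans (le_max_right _ _)
    have s1 := (Real.abs_sin_sub_sin_le x.1 y.1).trans h1
    have s2 := (Real.abs_cos_sub_cos_le x.1 y.1).trans h1
    have s3 := (Real.abs_cos_sub_cos_le x.2.2 y.2.2).trans h3
    have s4 := (tdw_tanh_lip x.2.1 y.2.1).trans h2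
    have s5 := (tdw_sech_lip x.2.1 y.2.1).trans h2
    have m1 := tdw_mul_lip (Real.abs_tanh_lt_one x.2.1).le (Real.abs_sin_le_one y.1) s4 s1
    have m2 := tdw_mul_lip (a := (Real.cosh x.2.1)⁻¹)
      (by rw [abs_of_pos (tdw_sech_bd _).1]; exact (tdw_sech_bd _).2)
      (Real.abs_cos_le_one y.2.2) s5 s3
    have hKv : ((4 + 4 * ⟨μ, hμ.le⟩ : NNReal) : ℝ) = 4 + 4 * μ := by push_cast; rfl
    rw [hKv]
    have hb : dist x y ≤ (4 + 4 * μ) * dist x y := by nlinarith [mul_nonneg hμ.le hd0]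
    rw [Prod.dist_eq, Prod.dist_eq, Real.dist_eq, Real.dist_eq, Real.dist_eq]
    refine max_le ?_ (max_le (s2.trans hb) (s1.trans hb))
    simp only [F]
    rw [abs_le] at *
    constructor <;> nlinarith
  have hM : ∀ c x, ‖F x + c • ((1:ℝ), (0:ℝ), (0:ℝ))‖ ≤ (2 + 2 * ⟨μ, hμ.le⟩ + ⟨|c|, abs_nonneg c⟩ : NNReal) := by
    intro c x
    have hKv : ((2 + 2 * ⟨μ, hμ.le⟩ + ⟨|c|, abs_nonneg c⟩ : NNReal) : ℝ) = 2 + 2 * μ + |c| := by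
      push_cast; rfl
    rw [hKv]
    have c0 := abs_nonneg c
    have t1 : |Real.tanh x.2.1 * Real.sin x.1| ≤ 1 := by
      rw [abs_mul]
      exact mul_le_one₀ (Real.abs_tanh_lt_one x.2.1).le (abs_nonneg _) (Real.abs_sin_le_one _)
    have t2 : |(Real.cosh x.2.1)⁻¹ * Real.cos x.2.2| ≤ 1 := by
      rw [abs_mul, abs_of_pos (tdw_sech_bd _).1]
      exact mul_le_one₀ (tdw_sech_bd _).2 (abs_nonneg _) (Real.abs_cos_le_one _)
    have t3 := Real.abs_sin_le_one x.1
    have t4 := Real.abs_cos_le_one x.1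
    simp only [F, Prod.norm_def, Prod.fst_add, Prod.snd_add, Prod.smul_mk, smul_eq_mul, mul_one,
      mul_zero, add_zero, Real.norm_eq_abs]
    refine max_le ?_ (max_le (by linarith) (by linarith))
    have := neg_abs_le c
    have := le_abs_self c
    rw [abs_le] at t1 t2 ⊢
    constructor <;> nlinarith
  have hK' : ∀ c : ℝ, LipschitzWith (4 + 4 * ⟨μ, hμ.le⟩ : NNReal)
      (fun x => F x + c • ((1:ℝ), (0:ℝ), (0:ℝ))) := by
    intro c x y
    simpa using! hK x y
  choose γ hγ0 hγ using fun c : ℝ =>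
    tdw_global_exists _ _ _ (hK' c) (hM c) ((0:ℝ), (0:ℝ), φ₀)
  refine ⟨fun c t => (γ c t).1, fun c t => (γ c t).2.1, fun c t => (γ c t).2.2, ?_, ?_, ?_, ?_, ?_⟩
  · intro c; simp [hγ0]
  · intro c t
    have := (hasFDerivAt_fst (𝕜 := ℝ) (p := γ c t)).comp_hasDerivAt t (hγ c t)
    simpa [F, Function.comp_def] using! this
  · intro c t
    have := (hasFDerivAt_fst (𝕜 := ℝ) (p := (γ c t).2)).comp_hasDerivAt t
      ((hasFDerivAt_snd (𝕜 := ℝ) (p := γ c t)).comp_hasDerivAt t (hγ c t))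
    simpa [F, Function.comp_def] using! this
  · intro c t
    have := (hasFDerivAt_snd (𝕜 := ℝ) (p := (γ c t).2)).comp_hasDerivAt t
      ((hasFDerivAt_snd (𝕜 := ℝ) (p := γ c t)).comp_hasDerivAt t (hγ c t))
    simpa [F, Function.comp_def] using! this
  · intro T c₀ δ hδ
    filter_upwards [tdw_dep F _ hK _ γ _ hγ0 hγ T c₀ δ hδ] with c hc t ht
    have h := hc t ht
    rw [Prod.dist_eq, Prod.dist_eq, max_lt_iff, max_lt_iff, Real.dist_eq, Real.dist_eq] at h
    exact ⟨h.1, h.2.1⟩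

theorem tdw_mono {f f' : ℝ → ℝ} {a b : ℝ} (hf : ∀ t, HasDerivAt f (f' t) t)
    (h : ∀ t ∈ Icc a b, 0 ≤ f' t) : MonotoneOn f (Icc a b) := by
  refine monotoneOn_of_deriv_nonneg (convex_Icc a b)
    (fun t _ => (hf t).continuousAt.continuousWithinAt)
    (fun t _ => (hf t).differentiableAt.differentiableWithinAt) ?_
  intro t ht
  rw [(hf t).deriv]
  exact h t (interior_subset ht)

theorem tdw_first {h : ℝ → ℝ} (hc : Continuous h) {a b : ℝ} (hab : a ≤ b) (ha : 0 < h a)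
    (hb : h b ≤ 0) : ∃ T, a < T ∧ T ≤ b ∧ h T = 0 ∧ ∀ s ∈ Ico a T, 0 < h s := by
  have hcl : IsCompact (Icc a b ∩ {t | h t ≤ 0}) :=
    isCompact_Icc.inter_right (isClosed_le hc continuous_const)
  obtain ⟨T, hT, hmin⟩ := hcl.exists_isLeast ⟨b, ⟨hab, le_rfl⟩, hb⟩
  have hTa : a ≠ T := by
    rintro rfl
    exact absurd hT.2 (not_le.2 ha)
  have haT : a < T := lt_of_le_of_ne hT.1.1 hTa
  have hpos : ∀ s ∈ Ico a T, 0 < h s := by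
    intro s hs
    by_contra hn
    exact absurd (hmin ⟨⟨hs.1, hs.2.le.trans hT.1.2⟩, not_lt.1 hn⟩) (not_le.2 hs.2)
  refine ⟨T, haT, hT.1.2, le_antisymm hT.2 ?_, hpos⟩
  have hTcl : T ∈ closure (Ico a T) := by rw [closure_Ico hTa]; exact ⟨haT.le, le_rfl⟩
  exact closure_minimal (fun s hs => (hpos s hs).le) (isClosed_le continuous_const hc) hTcl

theorem tdw_tanh_mono {x y : ℝ} (h : x ≤ y) : Real.tanh x ≤ Real.tanh y := by
  refine tdw_mono tdw_hasDerivAt_tanh (fun t _ => by positivity) (a := x) (b := y)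
    ⟨le_rfl, h⟩ ⟨h, le_rfl⟩ h

theorem tdw_tanh_nonneg {x : ℝ} (h : 0 ≤ x) : 0 ≤ Real.tanh x := by
  simpa using tdw_tanh_mono h

theorem tdw_tanh_one : 1 / 2 ≤ Real.tanh 1 := by
  rw [Real.tanh_eq_sinh_div_cosh, div_le_div_iff₀ (by norm_num) (Real.cosh_pos 1),
    Real.sinh_eq, Real.cosh_eq]
  have h1 := Real.add_one_le_exp (1:ℝ)
  have h2 : Real.exp (-1) ≤ 1 / 2 := by
    rw [Real.exp_neg, one_div]
    exact inv_anti₀ (by norm_num) (by linarith)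
  linarith

theorem tdw_cos_half {x : ℝ} (h : |x| ≤ 1) : 1 / 2 ≤ Real.cos x := by
  have := Real.one_sub_sq_div_two_le_cos (x := x)
  have h2 : x ^ 2 ≤ 1 := by rw [← sq_abs]; nlinarith [abs_nonneg x]
  linarith

theorem tdw_cos_nonneg {x : ℝ} (h : |x| ≤ Real.pi / 2) : 0 ≤ Real.cos x :=
  Real.cos_nonneg_of_mem_Icc (abs_le.1 h)

theorem tdw_abs_le_one {x : ℝ} (h : |x| ≤ Real.pi / 2) (hs : |Real.sin x| ≤ 1 / 4) : |x| ≤ 1 := by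
  have h1 := Real.mul_le_sin (abs_nonneg x) h
  have h2 : Real.sin |x| ≤ |Real.sin x| := by
    rcases abs_cases x with ⟨h, _⟩ | ⟨h, _⟩ <;> rw [h]
    · exact le_abs_self _
    · rw [Real.sin_neg]; exact neg_le_abs _
  have h3 : 2 / Real.pi * |x| ≤ 1 / 4 := by linarith
  rw [div_mul_eq_mul_div, div_le_iff₀ Real.pi_pos] at h3
  linarith [Real.pi_le_four]

theorem tdw_bound {ρ z r : ℝ → ℝ} {μ T : ℝ} (hμ0 : 0 < μ) (hμ : μ ≤ 1 / 16)
    (hρ : ∀ t, HasDerivAt ρ (r t) t) (hz : ∀ t, HasDerivAt z (Real.cos (ρ t)) t)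
    (hr : ∀ t, |r t - 2 * Real.tanh (z t) * Real.sin (ρ t)| ≤ 4 * μ)
    (hρ0 : ρ 0 = 0) (hz0 : z 0 = 0)
    (h1 : ∀ t ∈ Icc 0 T, |ρ t| ≤ Real.pi / 2)
    (h2 : ∀ t ∈ Icc 0 T, |Real.tanh (z t) * Real.sin (ρ t)| ≤ 2 * μ) :
    ∀ t ∈ Icc 0 T, |ρ t| ≤ 1 ∧ t / 2 ≤ z t := by
  have hr' : ∀ t ∈ Icc 0 T, |r t| ≤ 1 / 2 := by
    intro t ht
    have a1 := abs_le.1 (hr t)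
    have a2 := abs_le.1 (h2 t ht)
    rw [abs_le]
    constructor <;> linarith [a1.1, a1.2, a2.1, a2.2]
  have hlin : ∀ t ∈ Icc 0 T, |ρ t| ≤ t / 2 := by
    intro t ht
    have := norm_image_sub_le_of_norm_deriv_le_segment' (f := ρ) (f' := r) (C := 1 / 2)
      (fun s _ => (hρ s).hasDerivWithinAt) (fun s hs => hr' s ⟨hs.1, hs.2.le⟩) t ht
    rw [hρ0, Real.norm_eq_abs] at this
    simp only [sub_zero] at this
    linarith
  have hz2 : ∀ a : ℝ, (∀ t ∈ Icc 0 a, |ρ t| ≤ 1) → ∀ t ∈ Icc 0 a, t / 2 ≤ z t := by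
    intro a ha t ht
    have hd : ∀ s, HasDerivAt (fun s => z s - s / 2) (Real.cos (ρ s) - 1 / 2) s := fun s =>
      (hz s).sub ((hasDerivAt_id s).div_const 2)
    have := tdw_mono hd (a := 0) (b := a) (fun s hs => by linarith [tdw_cos_half (ha s hs)])
      ⟨le_rfl, ht.1.trans ht.2⟩ ht ht.1
    simp only [hz0] at this
    linarith
  have hall : ∀ t ∈ Icc 0 T, |ρ t| ≤ 1 := by
    intro t ht
    rcases le_total t 2 with h | h
    · linarith [hlin t ht]
    · have hz1 := hz2 2 (fun s hs => by
        linarith [hlin s ⟨hs.1, hs.2.trans (h.trans ht.2)⟩, hs.2]) 2 ⟨by norm_num, le_rfl⟩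
      have hm := tdw_mono hz (a := 0) (b := T) (fun s hs => tdw_cos_nonneg (h1 s hs))
        ⟨by norm_num, h.trans ht.2⟩ ht h
      have htz : 1 / 2 ≤ Real.tanh (z t) :=
        tdw_tanh_one.trans (tdw_tanh_mono (by linarith))
      have hg := h2 t ht
      rw [abs_mul, abs_of_nonneg (by linarith)] at hg
      refine tdw_abs_le_one (h1 t ht) ?_
      nlinarith [abs_nonneg (Real.sin (ρ t))]
  exact fun t ht => ⟨hall t ht, hz2 T hall t ht⟩

theorem tdw_barrier {ρ z r : ℝ → ℝ} {μ a b : ℝ} (hμ0 : 0 < μ)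
    (hρ : ∀ t, HasDerivAt ρ (r t) t) (hz : ∀ t, HasDerivAt z (Real.cos (ρ t)) t)
    (hr : ∀ t, |r t - 2 * Real.tanh (z t) * Real.sin (ρ t)| ≤ 4 * μ)
    (hab : a ≤ b) (hza : 0 ≤ z a)
    (h1 : ∀ t ∈ Icc a b, |ρ t| ≤ Real.pi / 2)
    (hg : 2 * μ < Real.tanh (z a) * Real.sin (ρ a)) :
    2 * μ < Real.tanh (z b) * Real.sin (ρ b) := by
  by_contra hcon
  have hgd : ∀ t, HasDerivAt (fun t => Real.tanh (z t) * Real.sin (ρ t))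
      ((1 / Real.cosh (z t) ^ 2 * Real.cos (ρ t)) * Real.sin (ρ t) +
        Real.tanh (z t) * (Real.cos (ρ t) * r t)) t := fun t =>
    ((tdw_hasDerivAt_tanh (z t)).comp t (hz t)).mul (hρ t).sin
  have hcont : Continuous (fun t => Real.tanh (z t) * Real.sin (ρ t) - 2 * μ) :=
    (continuous_iff_continuousAt.2 fun t => (hgd t).continuousAt).sub continuous_const
  obtain ⟨T, haT, hTb, hT0, hpos⟩ := tdw_first hcont hab (by linarith) (by linarith)
  have hge : ∀ s ∈ Icc a T, 2 * μ ≤ Real.tanh (z s) * Real.sin (ρ s) := by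
    intro s hs
    rcases hs.2.lt_or_eq with h | h
    · linarith [hpos s ⟨hs.1, h⟩]
    · rw [h]; linarith
  have hmono := tdw_mono hgd (a := a) (b := T) (fun s hs => by
    have hcos := tdw_cos_nonneg (h1 s ⟨hs.1, hs.2.trans hTb⟩)
    have hzs : z a ≤ z s := tdw_mono hz (a := a) (b := b) (fun u hu => tdw_cos_nonneg (h1 u hu))
      ⟨le_rfl, hab⟩ ⟨hs.1, hs.2.trans hTb⟩ hs.1
    have htn := tdw_tanh_nonneg (hza.trans hzs)
    have hgs := hge s hs
    have hsin : 0 ≤ Real.sin (ρ s) := by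
      by_contra hn
      nlinarith
    have hrs : 0 ≤ r s := by
      have := (abs_le.1 (hr s)).1
      linarith
    positivity) ⟨le_rfl, haT.le⟩ ⟨haT.le, le_rfl⟩ haT.le
  simp only at hmono
  linarith

theorem tdw_q_deriv {ρ z r : ℝ → ℝ} (hρ : ∀ t, HasDerivAt ρ (r t) t)
    (hz : ∀ t, HasDerivAt z (Real.cos (ρ t)) t) (t : ℝ) :
    HasDerivAt (fun t => Real.sin (ρ t) / Real.cosh (z t) ^ 2)
      (Real.cos (ρ t) * (r t - 2 * Real.tanh (z t) * Real.sin (ρ t)) / Real.cosh (z t) ^ 2) t := by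
  have hc := (Real.cosh_pos (z t)).ne'
  have h := (hρ t).sin.fun_div ((hz t).cosh.fun_pow 2) (pow_ne_zero 2 hc)
  refine h.congr_deriv ?_
  rw [Real.tanh_eq_sinh_div_cosh]
  field_simp
  ring

theorem tdw_q_mono {ρ z r : ℝ → ℝ} {T : ℝ} (hρ : ∀ t, HasDerivAt ρ (r t) t)
    (hz : ∀ t, HasDerivAt z (Real.cos (ρ t)) t)
    (h1 : ∀ t ∈ Icc 0 T, |ρ t| ≤ Real.pi / 2)
    (hr : ∀ t ∈ Icc 0 T, 2 * Real.tanh (z t) * Real.sin (ρ t) ≤ r t) :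
    MonotoneOn (fun t => Real.sin (ρ t) / Real.cosh (z t) ^ 2) (Icc 0 T) :=
  tdw_mono (tdw_q_deriv hρ hz) fun t ht =>
    div_nonneg (mul_nonneg (tdw_cos_nonneg (h1 t ht)) (sub_nonneg.2 (hr t ht))) (by positivity)

theorem tdw_q_nonneg {ρ z r : ℝ → ℝ} {T : ℝ} (hρ : ∀ t, HasDerivAt ρ (r t) t)
    (hz : ∀ t, HasDerivAt z (Real.cos (ρ t)) t) (hρ0 : ρ 0 = 0)
    (h1 : ∀ t ∈ Icc 0 T, |ρ t| ≤ Real.pi / 2)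
    (hr : ∀ t ∈ Icc 0 T, 2 * Real.tanh (z t) * Real.sin (ρ t) ≤ r t) :
    ∀ t ∈ Icc 0 T, 0 ≤ Real.sin (ρ t) ∧ 0 ≤ ρ t := by
  intro t ht
  have h := tdw_q_mono hρ hz h1 hr ⟨le_rfl, ht.1.trans ht.2⟩ ht ht.1
  simp only [hρ0, Real.sin_zero, zero_div] at h
  have hc : 0 < Real.cosh (z t) ^ 2 := by have := Real.cosh_pos (z t); positivity
  have hs : 0 ≤ Real.sin (ρ t) := by
    by_contra hn
    exact absurd h (not_le.2 (div_neg_of_neg_of_pos (not_le.1 hn) hc))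
  refine ⟨hs, ?_⟩
  by_contra hn
  have := abs_le.1 (h1 t ht)
  have := Real.sin_neg_of_neg_of_neg_pi_lt (not_le.1 hn) (by linarith [Real.pi_pos])
  linarith

theorem tdw_blow {ρ z r : ℝ → ℝ} (hρ : ∀ t, HasDerivAt ρ (r t) t)
    (hz : ∀ t, HasDerivAt z (Real.cos (ρ t)) t) (hρ0 : ρ 0 = 0) (hz0 : z 0 = 0)
    (h1 : ∀ t, 0 ≤ t → |ρ t| ≤ Real.pi / 2)
    (hr : ∀ t, 0 ≤ t → 2 * Real.tanh (z t) * Real.sin (ρ t) ≤ r t)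
    (hr0 : 0 < r 0) (hzt : ∀ t, 0 ≤ t → t / 2 ≤ z t) : False := by
  have hq0 := tdw_q_deriv hρ hz 0
  rw [hasDerivAt_iff_tendsto_slope] at hq0
  have hev := (hq0.mono_left (nhdsGT_le_nhdsNE (0:ℝ))).eventually
    (lt_mem_nhds (show (0:ℝ) < _ by simpa [hρ0, hz0] using hr0))
  obtain ⟨t₁, ht, ht₁⟩ := (hev.and self_mem_nhdsWithin).exists
  have ht₁ : 0 < t₁ := ht₁
  simp only [slope_def_field, hρ0, Real.sin_zero, zero_div, sub_zero] at ht
  have hq1 : 0 < Real.sin (ρ t₁) / Real.cosh (z t₁) ^ 2 := by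
    have := mul_pos ht ht₁
    rwa [div_mul_cancel₀ _ ht₁.ne'] at this
  set q := Real.sin (ρ t₁) / Real.cosh (z t₁) ^ 2 with hq
  set t := t₁ + 2 * (1 + 1 / q) with htd
  have hip : 0 < 1 / q := by positivity
  have ht0 : t₁ ≤ t := by linarith
  have hm := tdw_q_mono (T := t) hρ hz (fun s hs => h1 s hs.1) (fun s hs => hr s hs.1)
    ⟨ht₁.le, ht0⟩ ⟨ht₁.le.trans ht0, le_rfl⟩ ht0
  simp only [← hq] at hm
  have hcp : 0 < Real.cosh (z t) ^ 2 := by have := Real.cosh_pos (z t); positivity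
  rw [le_div_iff₀ hcp] at hm
  have hzt' : 1 + 1 / q ≤ z t := by linarith [hzt t (by linarith)]
  have hsinh : z t ≤ Real.sinh (z t) := Real.self_le_sinh_iff.2 (by linarith)
  have hcs := Real.cosh_sq (z t)
  have hs1 := Real.sin_le_one (ρ t)
  have hqq : q * (1 / q) = 1 := by field_simp
  have : 1 + 1 / q ≤ Real.cosh (z t) ^ 2 := by nlinarith
  nlinarith

theorem tdw_closure_le {f : ℝ → ℝ} (hf : Continuous f) {a T m : ℝ} (haT : a < T)
    (h : ∀ s ∈ Ico a T, f s ≤ m) : ∀ s ∈ Icc a T, f s ≤ m := by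
  intro s hs
  rw [← closure_Ico haT.ne] at hs
  exact closure_minimal h (isClosed_le hf continuous_const) hs

theorem tdw_core {ρ z r : ℝ → ℝ} {μ : ℝ} (hμ0 : 0 < μ) (hμ : μ ≤ 1 / 16)
    (hρ : ∀ t, HasDerivAt ρ (r t) t) (hz : ∀ t, HasDerivAt z (Real.cos (ρ t)) t)
    (hr : ∀ t, |r t - 2 * Real.tanh (z t) * Real.sin (ρ t)| ≤ 4 * μ)
    (hρ0 : ρ 0 = 0) (hz0 : z 0 = 0)
    (hg : ∀ T, 0 ≤ T → (∀ s ∈ Icc 0 T, |ρ s| < Real.pi / 2) →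
      |Real.tanh (z T) * Real.sin (ρ T)| ≤ 2 * μ) :
    ∀ t, 0 ≤ t → |ρ t| ≤ 1 ∧ t / 2 ≤ z t := by
  have hcρ : Continuous ρ := continuous_iff_continuousAt.2 fun t => (hρ t).continuousAt
  have hcz : Continuous z := continuous_iff_continuousAt.2 fun t => (hz t).continuousAt
  have hct : Continuous Real.tanh :=
    continuous_iff_continuousAt.2 fun t => (tdw_hasDerivAt_tanh t).continuousAt
  have hcg : Continuous (fun t => |Real.tanh (z t) * Real.sin (ρ t)|) := by fun_prop
  have hlt : ∀ t, 0 ≤ t → |ρ t| < Real.pi / 2 := by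
    intro t ht
    by_contra hcon
    obtain ⟨T, hT0, hTt, hT, hpos⟩ := tdw_first (h := fun t => Real.pi / 2 - |ρ t|)
      (by fun_prop) ht (by simp [hρ0, Real.pi_pos]) (by linarith)
    have h1 : ∀ s ∈ Icc 0 T, |ρ s| ≤ Real.pi / 2 :=
      tdw_closure_le hcρ.abs hT0 fun s hs => by linarith [hpos s hs]
    have h2 := tdw_closure_le hcg hT0 (m := 2 * μ) fun s hs => hg s hs.1 fun u hu => by
      linarith [hpos u ⟨hu.1, hu.2.trans_lt hs.2⟩]
    have := (tdw_bound hμ0 hμ hρ hz hr hρ0 hz0 h1 h2 T ⟨hT0.le, le_rfl⟩).1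
    linarith [Real.pi_gt_three]
  intro t ht
  exact tdw_bound hμ0 hμ hρ hz hr hρ0 hz0 (T := t) (fun s hs => (hlt s hs.1).le)
    (fun s hs => hg s hs.1 fun u hu => hlt u hu.1) t ⟨ht, le_rfl⟩

theorem tdw_forcing {μ c x y : ℝ} (hμ : 0 < μ) (h0 : 0 ≤ c) (h1 : c ≤ 2 * μ) (w : ℝ) :
    |(w - 2 * μ * (Real.cosh x)⁻¹ * Real.cos y + c) - w| ≤ 4 * μ := by
  have t2 : |(Real.cosh x)⁻¹ * Real.cos y| ≤ 1 := by
    rw [abs_mul, abs_of_pos (tdw_sech_bd _).1]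
    exact mul_le_one₀ (tdw_sech_bd _).2 (abs_nonneg _) (Real.abs_cos_le_one _)
  rw [abs_le] at t2 ⊢
  constructor <;> nlinarith

theorem tdw_caseA {ρ z φ : ℝ → ℝ} {μ φ₀ : ℝ} (hμ0 : 0 < μ) (hμ : μ ≤ 1 / 16)
    (hφ1 : Real.pi / 2 - 1 / 10 < φ₀) (hφ2 : φ₀ < Real.pi / 2)
    (hρ : ∀ t, HasDerivAt ρ (2 * Real.tanh (z t) * Real.sin (ρ t)
        - 2 * μ * (Real.cosh (z t))⁻¹ * Real.cos (φ t) + 2 * μ) t)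
    (hz : ∀ t, HasDerivAt z (Real.cos (ρ t)) t)
    (hρ0 : ρ 0 = 0) (hz0 : z 0 = 0) (hφ0 : φ 0 = φ₀)
    (hA : ∀ T, 0 ≤ T → (∀ s ∈ Icc 0 T, |ρ s| < Real.pi / 2) →
      Real.tanh (z T) * Real.sin (ρ T) ≤ 2 * μ) : False := by
  have hr : ∀ t, 2 * Real.tanh (z t) * Real.sin (ρ t) ≤ 2 * Real.tanh (z t) * Real.sin (ρ t)
        - 2 * μ * (Real.cosh (z t))⁻¹ * Real.cos (φ t) + 2 * μ := by
    intro t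
    have t2 : |(Real.cosh (z t))⁻¹ * Real.cos (φ t)| ≤ 1 := by
      rw [abs_mul, abs_of_pos (tdw_sech_bd _).1]
      exact mul_le_one₀ (tdw_sech_bd _).2 (abs_nonneg _) (Real.abs_cos_le_one _)
    have := (abs_le.1 t2).2
    nlinarith
  have hcore := tdw_core hμ0 hμ hρ hz
    (fun t => tdw_forcing hμ0 (by linarith) le_rfl _) hρ0 hz0 (fun T hT hs => by
      have hs' : ∀ s ∈ Icc 0 T, |ρ s| ≤ Real.pi / 2 := fun s h => (hs s h).le
      have h1 := (tdw_q_nonneg hρ hz hρ0 hs' (fun t _ => hr t) T ⟨hT, le_rfl⟩).1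
      have h2 := tdw_mono hz (fun s h => tdw_cos_nonneg (hs' s h)) ⟨le_rfl, hT⟩ ⟨hT, le_rfl⟩ hT
      rw [hz0] at h2
      rw [abs_of_nonneg (mul_nonneg (tdw_tanh_nonneg h2) h1)]
      exact hA T hT hs)
  refine tdw_blow hρ hz hρ0 hz0 (fun t ht => ?_) (fun t _ => hr t) ?_ (fun t ht => (hcore t ht).2)
  · linarith [(hcore t ht).1, Real.pi_gt_three]
  · simp only [hρ0, hz0, hφ0, Real.sin_zero, Real.cosh_zero]
    have : Real.cos φ₀ < 1 := by
      rw [← Real.cos_zero]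
      exact Real.cos_lt_cos_of_nonneg_of_le_pi_div_two le_rfl hφ2.le
        (by linarith [Real.pi_gt_three])
    nlinarith

theorem tdw_caseB {ρ z φ : ℝ → ℝ} {μ φ₀ : ℝ} (hμ0 : 0 < μ) (hμ : μ ≤ 1 / 16)
    (hφ1 : Real.pi / 2 - 1 / 10 < φ₀) (hφ2 : φ₀ < Real.pi / 2)
    (hρ : ∀ t, HasDerivAt ρ (2 * Real.tanh (z t) * Real.sin (ρ t)
        - 2 * μ * (Real.cosh (z t))⁻¹ * Real.cos (φ t) + 0) t)
    (hz : ∀ t, HasDerivAt z (Real.cos (ρ t)) t)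
    (hφ : ∀ t, HasDerivAt φ (Real.sin (ρ t)) t)
    (hρ0 : ρ 0 = 0) (hz0 : z 0 = 0) (hφ0 : φ 0 = φ₀)
    (hB : ∀ T, 0 ≤ T → (∀ s ∈ Icc 0 T, |ρ s| < Real.pi / 2) →
      -(2 * μ) ≤ Real.tanh (z T) * Real.sin (ρ T)) : False := by
  have hpi := Real.pi_gt_d2
  have hcρ : Continuous ρ := continuous_iff_continuousAt.2 fun t => (hρ t).continuousAt
  have hcz : Continuous z := continuous_iff_continuousAt.2 fun t => (hz t).continuousAt
  have hcφ : Continuous φ := continuous_iff_continuousAt.2 fun t => (hφ t).continuousAt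
  have hct : Continuous Real.tanh :=
    continuous_iff_continuousAt.2 fun t => (tdw_hasDerivAt_tanh t).continuousAt
  have hcg : Continuous (fun t => |Real.tanh (z t) * Real.sin (ρ t)|) := by fun_prop
  set r : ℝ → ℝ := fun t => 2 * Real.tanh (z t) * Real.sin (ρ t)
        - 2 * μ * (Real.cosh (z t))⁻¹ * Real.cos (φ t) + 0 with hrdef
  have hρn : ∀ t, HasDerivAt (fun t => -ρ t) (-r t) t := fun t => (hρ t).neg
  have hzn : ∀ t, HasDerivAt z (Real.cos (-ρ t)) t := fun t => by
    rw [Real.cos_neg]; exact hz t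
  have hrle : ∀ t, |φ t| ≤ Real.pi / 2 → r t ≤ 2 * Real.tanh (z t) * Real.sin (ρ t) := by
    intro t ht
    have h1 := tdw_cos_nonneg ht
    have h2 := (tdw_sech_bd (z t)).1
    have : 0 ≤ 2 * μ * (Real.cosh (z t))⁻¹ * Real.cos (φ t) := by positivity
    simp only [hrdef]
    linarith
  have main : ∀ T, 0 < T → (∀ s ∈ Ico 0 T, |φ s| < Real.pi / 2 ∧ |ρ s| < Real.pi / 2) →
      (∀ s ∈ Icc 0 T, |ρ s| ≤ 1 ∧ s / 2 ≤ z s) ∧ |φ T| < Real.pi / 2 := by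
    intro T hT hs
    have hρ1 : ∀ s ∈ Icc 0 T, |ρ s| ≤ Real.pi / 2 :=
      tdw_closure_le hcρ.abs hT fun s h => (hs s h).2.le
    have hφ1' : ∀ s ∈ Icc 0 T, |φ s| ≤ Real.pi / 2 :=
      tdw_closure_le hcφ.abs hT fun s h => (hs s h).1.le
    have hq : ∀ s ∈ Icc 0 T, Real.sin (ρ s) ≤ 0 ∧ ρ s ≤ 0 := by
      intro s h
      have := tdw_q_nonneg (T := T) hρn hzn (by simp [hρ0]) (fun u hu => by
        rw [abs_neg]; exact hρ1 u hu) (fun u hu => by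
        rw [Real.sin_neg]; linarith [hrle u (hφ1' u hu)]) s h
      rw [Real.sin_neg] at this
      constructor <;> linarith [this.1, this.2]
    have hzpos : ∀ s ∈ Icc 0 T, 0 ≤ z s := by
      intro s h
      have := tdw_mono hz (a := 0) (b := T) (fun u hu => tdw_cos_nonneg (hρ1 u hu))
        ⟨le_rfl, hT.le⟩ h h.1
      rwa [hz0] at this
    have hg := tdw_closure_le hcg hT (m := 2 * μ) (fun s h => by
      have hsc : s ∈ Icc 0 T := ⟨h.1, h.2.le⟩
      rw [abs_le]
      refine ⟨hB s h.1 fun u hu => (hs u ⟨hu.1, hu.2.trans_lt h.2⟩).2, ?_⟩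
      have := mul_nonneg (tdw_tanh_nonneg (hzpos s hsc)) (neg_nonneg.2 (hq s hsc).1)
      linarith)
    have hb := tdw_bound hμ0 hμ hρ hz
      (fun t => tdw_forcing hμ0 le_rfl (by linarith) _) hρ0 hz0 hρ1 hg
    refine ⟨hb, ?_⟩
    have hup : φ T ≤ φ₀ := by
      have := tdw_mono (f := fun t => -φ t) (a := 0) (b := T) (fun t => (hφ t).neg)
        (fun s h => neg_nonneg.2 (hq s h).1) ⟨le_rfl, hT.le⟩ ⟨hT.le, le_rfl⟩ hT.le
      simp only [hφ0] at this
      linarith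
    have hlow1 : ∀ t, 0 ≤ t → φ₀ - t ≤ φ t := by
      intro t ht
      have := tdw_mono (f := fun t => φ t + t) (a := 0) (b := t)
        (fun t => (hφ t).add (hasDerivAt_id t))
        (fun s _ => by linarith [Real.neg_one_le_sin (ρ s)]) ⟨le_rfl, ht⟩ ⟨ht, le_rfl⟩ ht
      simp only [hφ0] at this
      linarith
    have hlow : φ₀ - 3 ≤ φ T := by
      rcases le_total T 2 with h | h
      · linarith [hlow1 T hT.le]
      · have := tdw_mono (f := fun t => φ t - ρ t) (a := 2) (b := T)
          (fun t => (hφ t).sub (hρ t))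
          (fun s hs => by
            have hsc : s ∈ Icc 0 T := ⟨by linarith [hs.1], hs.2⟩
            have h1 := hrle s (hφ1' s hsc)
            have h2 := (hq s hsc).1
            have h3 : 1 / 2 ≤ Real.tanh (z s) :=
              tdw_tanh_one.trans (tdw_tanh_mono (by linarith [(hb s hsc).2, hs.1]))
            have h1 : r s ≤ 2 * Real.tanh (z s) * Real.sin (ρ s) := h1
            show 0 ≤ Real.sin (ρ s) - r s
            nlinarith) ⟨le_rfl, h⟩ ⟨h, le_rfl⟩ h
        simp only at this
        have h2 := (hq 2 ⟨by norm_num, h⟩).2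
        have h3 := (abs_le.1 (hb T ⟨hT.le, le_rfl⟩).1).1
        linarith [hlow1 2 (by norm_num)]
    rw [abs_lt]
    constructor <;> linarith
  have hall : ∀ t, 0 ≤ t → |φ t| < Real.pi / 2 ∧ |ρ t| < Real.pi / 2 := by
    intro t ht
    by_contra hcon
    have hφa : |φ₀| < Real.pi / 2 := by rw [abs_lt]; constructor <;> linarith
    obtain ⟨T, hT0, hTt, hT, hpos⟩ := tdw_first
      (h := fun t => min (Real.pi / 2 - |φ t|) (Real.pi / 2 - |ρ t|))
      (by fun_prop) ht (by
        simp only [hρ0, hφ0, abs_zero]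
        exact lt_min (by linarith) (by linarith)) (by
        rw [not_and_or] at hcon
        rcases hcon with h | h
        · exact (min_le_left _ _).trans (by linarith)
        · exact (min_le_right _ _).trans (by linarith))
    have hm := main T hT0 (fun s hs => by
      have := lt_min_iff.1 (hpos s hs)
      constructor <;> linarith [this.1, this.2])
    have h1 := (hm.1 T ⟨hT0.le, le_rfl⟩).1
    have : 0 < min (Real.pi / 2 - |φ T|) (Real.pi / 2 - |ρ T|) :=
      lt_min (by linarith [hm.2]) (by linarith)
    exact absurd hT this.ne'
  have hcore : ∀ t, 0 ≤ t → |ρ t| ≤ 1 ∧ t / 2 ≤ z t := fun t ht =>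
    (main (t + 1) (by linarith) fun s hs => hall s hs.1).1 t ⟨ht, by linarith⟩
  refine tdw_blow hρn hzn (by simp [hρ0]) hz0 (fun t ht => ?_) (fun t ht => ?_) ?_
    (fun t ht => (hcore t ht).2)
  · rw [abs_neg]; exact (hall t ht).2.le
  · rw [Real.sin_neg]; linarith [hrle t (hall t ht).1.le]
  · simp only [hrdef, hρ0, hz0, hφ0, Real.sin_zero, Real.cosh_zero]
    have : 0 < Real.cos φ₀ := Real.cos_pos_of_mem_Ioo ⟨by linarith, hφ2⟩
    have := mul_pos hμ0 this
    norm_num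
    linarith

theorem tdw_open {R Z : ℝ → ℝ → ℝ} (hR : ∀ c, Continuous (R c)) (μ σ : ℝ)
    (hdep : ∀ T c₀ δ : ℝ, 0 < δ → ∀ᶠ c in 𝓝 c₀, ∀ t ∈ Icc 0 T,
      |R c t - R c₀ t| < δ ∧ |Z c t - Z c₀ t| < δ) :
    IsOpen {c | ∃ t, 0 ≤ t ∧ (∀ s ∈ Icc 0 t, |R c s| < Real.pi / 2) ∧
      2 * μ < σ * (Real.tanh (Z c t) * Real.sin (R c t))} := by
  have hct : Continuous Real.tanh :=
    continuous_iff_continuousAt.2 fun t => (tdw_hasDerivAt_tanh t).continuousAt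
  rw [isOpen_iff_mem_nhds]
  rintro c₀ ⟨t, ht, hs, hg⟩
  have hRt : Tendsto (fun c => R c t) (𝓝 c₀) (𝓝 (R c₀ t)) := by
    rw [Metric.tendsto_nhds]
    intro δ hδ
    filter_upwards [hdep t c₀ δ hδ] with c hc
    exact (hc t ⟨ht, le_rfl⟩).1
  have hZt : Tendsto (fun c => Z c t) (𝓝 c₀) (𝓝 (Z c₀ t)) := by
    rw [Metric.tendsto_nhds]
    intro δ hδ
    filter_upwards [hdep t c₀ δ hδ] with c hc
    exact (hc t ⟨ht, le_rfl⟩).2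
  have hgt : Tendsto (fun c => σ * (Real.tanh (Z c t) * Real.sin (R c t))) (𝓝 c₀)
      (𝓝 (σ * (Real.tanh (Z c₀ t) * Real.sin (R c₀ t)))) :=
    (((hct.tendsto _).comp hZt).mul ((Real.continuous_sin.tendsto _).comp hRt)).const_mul σ
  obtain ⟨m, hm, hmax⟩ := isCompact_Icc.exists_isMaxOn (s := Icc 0 t) ⟨0, le_rfl, ht⟩
    (hR c₀).abs.continuousOn
  filter_upwards [hgt.eventually (lt_mem_nhds hg),
    hdep t c₀ (Real.pi / 2 - |R c₀ m|) (by linarith [hs m hm])] with c h1 h2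
  refine ⟨t, ht, fun s hs' => ?_, h1⟩
  have a1 : |R c₀ s| ≤ |R c₀ m| := hmax hs'
  have a2 := (h2 s hs').1
  have a3 := abs_sub_abs_le_abs_sub (R c s) (R c₀ s)
  linarith

theorem tdw_normalized {μ φ₀ : ℝ} (hμ0 : 0 < μ) (hμ : μ ≤ 1 / 16)
    (hφ1 : Real.pi / 2 - 1 / 10 < φ₀) (hφ2 : φ₀ < Real.pi / 2) :
    ∃ c : ℝ, 0 < c ∧ c < 2 * μ ∧ ∃ ρ z φ : ℝ → ℝ, ρ 0 = 0 ∧ z 0 = 0 ∧ φ 0 = φ₀ ∧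
      (∀ t, HasDerivAt ρ (2 * Real.tanh (z t) * Real.sin (ρ t)
        - 2 * μ * (Real.cosh (z t))⁻¹ * Real.cos (φ t) + c) t) ∧
      (∀ t, HasDerivAt z (Real.cos (ρ t)) t) ∧
      (∀ t, HasDerivAt φ (Real.sin (ρ t)) t) ∧
      (∀ t, 0 ≤ t → |ρ t| ≤ 1 ∧ t / 2 ≤ z t) := by
  obtain ⟨R, Z, P, h0, hR, hZ, hP, hdep⟩ := tdw_family μ φ₀ hμ0
  have hRc : ∀ c, Continuous (R c) := fun c =>
    continuous_iff_continuousAt.2 fun t => (hR c t).continuousAt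
  let S : ℝ → Set ℝ := fun σ => {c | ∃ t, 0 ≤ t ∧ (∀ s ∈ Icc 0 t, |R c s| < Real.pi / 2) ∧
      2 * μ < σ * (Real.tanh (Z c t) * Real.sin (R c t))}
  have hopen : ∀ σ, IsOpen (S σ) := fun σ => tdw_open hRc μ σ hdep
  have hzpos : ∀ c t, 0 ≤ t → (∀ s ∈ Icc 0 t, |R c s| < Real.pi / 2) → 0 ≤ Z c t := by
    intro c t ht hs
    have := tdw_mono (hZ c) (a := 0) (b := t) (fun u hu => tdw_cos_nonneg (hs u hu).le)
        ⟨le_rfl, ht⟩ ⟨ht, le_rfl⟩ ht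
    rwa [(h0 c).2.1] at this
  have hA : 2 * μ ∈ S 1 := by
    by_contra hn
    refine tdw_caseA hμ0 hμ hφ1 hφ2 (hR (2 * μ)) (hZ _) (h0 _).1 (h0 _).2.1 (h0 _).2.2 ?_
    intro T hT hs
    by_contra hcon
    exact hn ⟨T, hT, hs, by linarith⟩
  have hB : 0 ∈ S (-1) := by
    by_contra hn
    refine tdw_caseB hμ0 hμ hφ1 hφ2 (hR 0) (hZ _) (hP _) (h0 _).1 (h0 _).2.1 (h0 _).2.2 ?_
    intro T hT hs
    by_contra hcon
    exact hn ⟨T, hT, hs, by linarith⟩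
  have hdisj : ∀ c ∈ Icc 0 (2 * μ), c ∈ S 1 → c ∈ S (-1) → False := by
    rintro c hc ⟨t, ht, hs, hg⟩ ⟨t', ht', hs', hg'⟩
    rcases le_total t t' with h | h
    · have := tdw_barrier hμ0 (hR c) (hZ c) (fun t => tdw_forcing hμ0 hc.1 hc.2 _) h
        (hzpos c t ht hs) (fun u hu => (hs' u ⟨ht.trans hu.1, hu.2⟩).le) (by linarith)
      linarith
    · have := tdw_barrier (ρ := fun t => -R c t) (z := Z c) hμ0 (fun t => (hR c t).neg)
        (fun t => by rw [Real.cos_neg]; exact hZ c t) (fun t => by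
          have := tdw_forcing (x := Z c t) (y := P c t) hμ0 hc.1 hc.2
            (2 * Real.tanh (Z c t) * Real.sin (R c t))
          rw [← abs_neg] at this
          rw [Real.sin_neg]
          convert this using 2
          ring) h
        (hzpos c t' ht' hs') (fun u hu => by
          rw [abs_neg]; exact (hs u ⟨ht'.trans hu.1, hu.2⟩).le) (by
          rw [Real.sin_neg]; linarith)
      rw [Real.sin_neg] at this
      linarith
  have hex : ∃ c ∈ Icc 0 (2 * μ), c ∉ S 1 ∧ c ∉ S (-1) := by
    by_contra hcon
    push Not at hcon
    obtain ⟨c, hc, hc1, hc2⟩ := isPreconnected_Icc (a := 0) (b := 2 * μ) (S 1) (S (-1))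
      (hopen 1) (hopen (-1)) (fun c hc => by
        by_cases h : c ∈ S 1
        · exact Or.inl h
        · exact Or.inr (hcon c hc h))
      ⟨2 * μ, ⟨by linarith, le_rfl⟩, hA⟩ ⟨0, ⟨le_rfl, by linarith⟩, hB⟩
    exact hdisj c hc hc1 hc2
  obtain ⟨c, hc, hc1, hc2⟩ := hex
  refine ⟨c, lt_of_le_of_ne hc.1 ?_, lt_of_le_of_ne hc.2 ?_, R c, Z c, P c, (h0 c).1, (h0 c).2.1,
    (h0 c).2.2, hR c, hZ c, hP c, ?_⟩
  · rintro rfl; exact hc2 hB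
  · rintro rfl; exact hc1 hA
  · refine tdw_core hμ0 hμ (hR c) (hZ c) (fun t => tdw_forcing hμ0 hc.1 hc.2 _)
      (h0 c).1 (h0 c).2.1 ?_
    intro T hT hs
    rw [abs_le]
    constructor
    · by_contra hcon
      exact hc2 ⟨T, hT, hs, by linarith⟩
    · by_contra hcon
      exact hc1 ⟨T, hT, hs, by linarith⟩

end helpers

/-- Local existence of traveling chiral domain walls: for sufficiently small
anisotropy `k` and ratio `λ/k`, and any tilting angle `φ₀ < π/2` close enough to
`π/2`, there is a velocity `c ∈ (0, 2λ)` and a solution of the traveling wall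
system with `ρ(0) = z(0) = 0`, `φ(0) = φ₀`, `|ρ| < π/2` for `ξ ≥ 0`, and `z`
increasing monotonically to `+∞`. -/
theorem exists_traveling_domain_wall :
    ∃ ε : ℝ, 0 < ε ∧
      ∀ k lam : ℝ, 0 < k → k < ε → 0 < lam → lam / k < ε → lam ≤ (2 / Real.pi) * k →
        ∃ N ∈ 𝓝 (Real.pi / 2), ∀ φ₀ ∈ N, φ₀ < Real.pi / 2 →
          ∃ c : ℝ, 0 < c ∧ c < 2 * lam ∧
            ∃ ρ z φ : ℝ → ℝ,
              ρ 0 = 0 ∧ z 0 = 0 ∧ φ 0 = φ₀ ∧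
              (∀ ξ : ℝ,
                HasDerivAt ρ (2 * k * Real.tanh (z ξ) * Real.sin (ρ ξ)
                    - 2 * lam * (Real.cosh (z ξ))⁻¹ * Real.cos (φ ξ) + c) ξ ∧
                HasDerivAt z (k * Real.cos (ρ ξ)) ξ ∧
                HasDerivAt φ (k * Real.sin (ρ ξ)) ξ) ∧
              (∀ ξ : ℝ, 0 ≤ ξ → |ρ ξ| < Real.pi / 2) ∧
              StrictMonoOn z (Set.Ici 0) ∧
              Tendsto z atTop atTop := by
  refine ⟨1 / 16, by norm_num, ?_⟩
  intro k lam hk _ hlam hratio _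
  refine ⟨Set.Ioi (Real.pi / 2 - 1 / 10), Ioi_mem_nhds (by linarith), ?_⟩
  intro φ₀ hφ1 hφ2
  have hkne : k ≠ 0 := hk.ne'
  obtain ⟨c, hc0, hc1, ρ, z, φ, hρ0, hz0, hφ0, hρ, hz, hφ, hb⟩ :=
    tdw_normalized (μ := lam / k) (div_pos hlam hk) hratio.le hφ1 hφ2
  have hlin : ∀ ξ : ℝ, HasDerivAt (fun ξ : ℝ => k * ξ) k ξ := fun ξ => by
    simpa using (hasDerivAt_id ξ).const_mul k
  have hzd : ∀ ξ : ℝ, HasDerivAt (fun ξ => z (k * ξ)) (k * Real.cos (ρ (k * ξ))) ξ := fun ξ =>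
    ((hz (k * ξ)).comp ξ (hlin ξ)).congr_deriv (by ring)
  refine ⟨k * c, mul_pos hk hc0, ?_, fun ξ => ρ (k * ξ), fun ξ => z (k * ξ), fun ξ => φ (k * ξ),
    by simpa using hρ0, by simpa using hz0, by simpa using hφ0, fun ξ => ⟨?_, hzd ξ, ?_⟩, ?_, ?_, ?_⟩
  · have := mul_lt_mul_of_pos_left hc1 hk
    have e : k * (2 * (lam / k)) = 2 * lam := by field_simp
    linarith
  · refine ((hρ (k * ξ)).comp ξ (hlin ξ)).congr_deriv ?_
    have hch := (Real.cosh_pos (z (k * ξ))).ne'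
    field_simp
  · exact ((hφ (k * ξ)).comp ξ (hlin ξ)).congr_deriv (by ring)
  · intro ξ hξ
    linarith [(hb (k * ξ) (by positivity)).1, Real.pi_gt_three]
  · refine strictMonoOn_of_deriv_pos (convex_Ici 0)
      (fun t _ => (hzd t).continuousAt.continuousWithinAt) ?_
    intro t ht
    rw [interior_Ici] at ht
    rw [(hzd t).deriv]
    have ht : 0 < t := ht
    have := tdw_cos_half (hb (k * t) (by positivity)).1
    positivity
  · have h1 : Tendsto (fun ξ : ℝ => (k / 2) * ξ) atTop atTop :=
      tendsto_id.const_mul_atTop (by positivity)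
    refine tendsto_atTop_mono' atTop ?_ h1
    filter_upwards [eventually_ge_atTop (0:ℝ)] with ξ hξ
    have := (hb (k * ξ) (by positivity)).2
    linarith
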